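/- Let X be a real Banach space with dim X ≥ 2 and let p ∈ [0,1]. Then MR_p(X) ≤ (4 − 3p)/(2 − p). -/

import Mathlib

open Filter

/-- The `p`-angular distance `α_p[x,y] = ‖ ‖x‖^(p-1) • x − ‖y‖^(p-1) • y ‖`. -/
noncomputable def alphaP {X : Type*} [NormedAddCommGroup X] [NormedSpace ℝ X]
    (p : ℝ) (x y : X) : ℝ :=
  ‖(‖x‖ ^ (p - 1)) • x - (‖y‖ ^ (p - 1)) • y‖

/-- The skew `p`-angular distance `β_p[x,y] = ‖ ‖y‖^(p-1) • x − ‖x‖^(p-1) • y ‖`. -/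
noncomputable def betaP {X : Type*} [NormedAddCommGroup X] [NormedSpace ℝ X]
    (p : ℝ) (x y : X) : ℝ :=
  ‖(‖y‖ ^ (p - 1)) • x - (‖x‖ ^ (p - 1)) • y‖

/-- The Maligranda–Rooin constant `MR_p(X)`. -/
noncomputable def MRconst (X : Type*) [NormedAddCommGroup X] [NormedSpace ℝ X]
    (p : ℝ) : ℝ :=
  sSup { r : ℝ | ∃ x y : X, x ≠ 0 ∧ y ≠ 0 ∧ betaP p x y ≠ 0 ∧
    r = alphaP p x y / betaP p x y }

/-- With `q = 1 - p`, `t = a / b` and `w = t ^ (-q)`: the scalar inequality behind the bound. -/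
lemma scalar_bound {q t w : ℝ} (hq : 0 ≤ q) (hw : 0 < w) (hw1 : w ≤ 1)
    (hq0 : q = 0 → w = 1) (hB : 1 - w ≤ q * (t - 1) * w) :
    1 - w ^ 2 ≤ ((1 + 3 * q) / (1 + q) - w) * (t - w) := by
  have h1q : 0 < 1 + q := by linarith
  have key : 2 * (1 - w) * ((1 + q) * w - q) ≤ (t - 1) * (1 + 3 * q - (1 + q) * w) := by
    rcases hq.eq_or_lt with h | h
    · have := hq0 h.symm
      subst this
      subst h
      simp
    · have hbr : 0 ≤ 1 + 3 * q - (1 + q) * w := by nlinarith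
      have h1 := mul_le_mul_of_nonneg_right hB hbr
      have h2 : 0 ≤ (1 - w) * ((1 - w) * (1 + 3 * q + 2 * q * (1 + q) * w)) := by
        have : 0 ≤ 1 - w := by linarith
        positivity
      have hqw : 0 < q * w := mul_pos h hw
      refine le_of_mul_le_mul_left ?_ hqw
      linarith
  have : ((1 + 3 * q) / (1 + q) - w) * (t - w) - (1 - w ^ 2)
      = ((t - 1) * (1 + 3 * q - (1 + q) * w) - 2 * (1 - w) * ((1 + q) * w - q)) / (1 + q) := by
    field_simp
    ring
  have h3 := div_nonneg (sub_nonneg.2 key) h1q.le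
  linarith

lemma alphaP_comm {X : Type*} [NormedAddCommGroup X] [NormedSpace ℝ X] (p : ℝ) (x y : X) :
    alphaP p x y = alphaP p y x := norm_sub_rev _ _

lemma betaP_comm {X : Type*} [NormedAddCommGroup X] [NormedSpace ℝ X] (p : ℝ) (x y : X) :
    betaP p x y = betaP p y x := norm_sub_rev _ _

lemma alphaP_le_of_norm_le {X : Type*} [NormedAddCommGroup X] [NormedSpace ℝ X] {p : ℝ}
    (hp0 : 0 ≤ p) (hp1 : p ≤ 1) {x y : X} (hy : y ≠ 0) (hxy : ‖y‖ ≤ ‖x‖) :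
    alphaP p x y ≤ (4 - 3 * p) / (2 - p) * betaP p x y := by
  have hb : 0 < ‖y‖ := norm_pos_iff.2 hy
  have ha : 0 < ‖x‖ := hb.trans_le hxy
  unfold alphaP betaP
  set t := ‖x‖ / ‖y‖ with ht_def
  set w := t ^ (p - 1) with hw_def
  set B := ‖y‖ ^ (p - 1) with hB_def
  have ht : 1 ≤ t := (one_le_div hb).2 hxy
  have ht0 : 0 < t := one_pos.trans_le ht
  have hw : 0 < w := Real.rpow_pos_of_pos ht0 _
  have hw1 : w ≤ 1 := Real.rpow_le_one_of_one_le_of_nonpos ht (by linarith)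
  have hB : 0 < B := Real.rpow_pos_of_pos hb _
  have hxt : ‖x‖ = t * ‖y‖ := by rw [ht_def]; field_simp
  have hA : ‖x‖ ^ (p - 1) = w * B := by
    rw [hxt, Real.mul_rpow ht0.le hb.le]
  have hbern : 1 - w ≤ (1 - p) * (t - 1) * w := by
    have h := rpow_one_add_le_one_add_mul_self (s := t - 1) (by linarith)
      (p := 1 - p) (by linarith) (by linarith)
    rw [add_sub_cancel] at h
    have hinv : t ^ (1 - p) * w = 1 := by
      rw [hw_def, ← Real.rpow_add ht0]
      simp
    have := mul_le_mul_of_nonneg_right h hw.le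
    linarith
  have hsc := scalar_bound (q := 1 - p) (by linarith) hw hw1
    (fun h => by rw [hw_def, show p - 1 = 0 by linarith, Real.rpow_zero]) hbern
  rw [show (1 + 3 * (1 - p)) / (1 + (1 - p)) = (4 - 3 * p) / (2 - p) by ring_nf] at hsc
  have hC : 1 ≤ (4 - 3 * p) / (2 - p) := (one_le_div (by linarith)).2 (by linarith)
  set C := (4 - 3 * p) / (2 - p)
  rw [hA]
  set β := ‖B • x - (w * B) • y‖ with hβ
  have hlow : B * ‖y‖ * (t - w) ≤ β := by
    have h := norm_sub_norm_le (B • x) ((w * B) • y)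
    rw [norm_smul_of_nonneg hB.le, norm_smul_of_nonneg (mul_pos hw hB).le, hxt] at h
    linarith
  have hup : ‖(w * B) • x - B • y‖ ≤ w * β + B * ‖y‖ * (1 - w ^ 2) := by
    have hdec : (w * B) • x - B • y
        = w • (B • x - (w * B) • y) - (B * (1 - w ^ 2)) • y := by module
    have h1 : 0 ≤ B * (1 - w ^ 2) := mul_nonneg hB.le (by nlinarith)
    rw [hdec]
    refine (norm_sub_le _ _).trans (le_of_eq ?_)
    rw [norm_smul_of_nonneg hw.le, norm_smul_of_nonneg h1]
    ring
  have h1 := mul_le_mul_of_nonneg_left hsc (mul_pos hB hb).le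
  have h2 := mul_le_mul_of_nonneg_left hlow (show 0 ≤ C - w by linarith)
  linarith

theorem stmt2 (X : Type*) [NormedAddCommGroup X] [NormedSpace ℝ X] [CompleteSpace X]
    (hdim : 2 ≤ Module.rank ℝ X) (p : ℝ) (hp0 : 0 ≤ p) (hp1 : p ≤ 1) :
    MRconst X p ≤ (4 - 3 * p) / (2 - p) := by
  refine Real.sSup_le ?_ (div_nonneg (by linarith) (by linarith))
  rintro r ⟨x, y, hx, hy, hβ, rfl⟩
  have hpos : 0 < betaP p x y := (norm_nonneg _).lt_of_ne' hβ
  rw [div_le_iff₀ hpos]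
  rcases le_total ‖y‖ ‖x‖ with h | h
  · exact alphaP_le_of_norm_le hp0 hp1 hy h
  · rw [alphaP_comm, betaP_comm]
    exact alphaP_le_of_norm_le hp0 hp1 hx h
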